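/- arXiv:1912.11267 — 3 statements merged into one kernel-verified Lean document; each statement's English description precedes it below -/
import Mathlib

section
/- Let D be a division ring. For all nonzero x, y ∈ D, the diagonal matrix diag(x y x⁻¹ y⁻¹, 1) belongs to the subgroup of GL₂(D) generated by U⁺ ∪ U⁻. -/
namespace Matrix

/-- The upper unipotent matrix with off-diagonal entry `a`, as a unit of `M₂(R)`. -/
def upperUnipotent {R : Type*} [Ring R] (a : R) : (Matrix (Fin 2) (Fin 2) R)ˣ where
  val := !![1, a; 0, 1]
  inv := !![1, -a; 0, 1]
  val_inv := by simp [one_fin_two]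
  inv_val := by simp [one_fin_two]

/-- The lower unipotent matrix with off-diagonal entry `a`, as a unit of `M₂(R)`. -/
def lowerUnipotent {R : Type*} [Ring R] (a : R) : (Matrix (Fin 2) (Fin 2) R)ˣ where
  val := !![1, 0; a, 1]
  inv := !![1, 0; -a, 1]
  val_inv := by simp [one_fin_two]
  inv_val := by simp [one_fin_two]

/-- A subgroup containing all unipotent matrices contains every antidiagonal matrix with
entries `a` and `-a⁻¹`. -/
theorem exists_mem_val_eq_antidiag {D : Type*} [DivisionRing D]
    {H : Subgroup (Matrix (Fin 2) (Fin 2) D)ˣ} (hu : ∀ a, upperUnipotent a ∈ H)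
    (hl : ∀ a, lowerUnipotent a ∈ H) {a : D} (ha : a ≠ 0) :
    ∃ g ∈ H, Units.val g = !![0, a; -a⁻¹, 0] := by
  refine ⟨upperUnipotent a * lowerUnipotent (-a⁻¹) * upperUnipotent a,
    H.mul_mem (H.mul_mem (hu _) (hl _)) (hu _), ?_⟩
  simp [upperUnipotent, lowerUnipotent, ha]

/-- A subgroup containing all unipotent matrices contains `diag(a, a⁻¹)`. -/
theorem exists_mem_val_eq_diag_inv {D : Type*} [DivisionRing D]
    {H : Subgroup (Matrix (Fin 2) (Fin 2) D)ˣ} (hu : ∀ a, upperUnipotent a ∈ H)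
    (hl : ∀ a, lowerUnipotent a ∈ H) {a : D} (ha : a ≠ 0) :
    ∃ g ∈ H, Units.val g = !![a, 0; 0, a⁻¹] := by
  obtain ⟨g, hg, hga⟩ := exists_mem_val_eq_antidiag hu hl ha
  obtain ⟨k, hk, hk1⟩ := exists_mem_val_eq_antidiag hu hl (neg_ne_zero.mpr (one_ne_zero (α := D)))
  refine ⟨g * k, H.mul_mem hg hk, ?_⟩
  simp [hga, hk1, inv_neg]

end Matrix

/-- For a division ring `D` and nonzero `x, y : D`, the diagonal matrix
`diag(x y x⁻¹ y⁻¹, 1)` lies in the subgroup of `GL₂(D) = (M₂(D))ˣ` generated by the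
elementary unipotent matrices `U⁺ ∪ U⁻`. -/
theorem stmt2 {D : Type*} [DivisionRing D]
    (Uplus Uminus : Set (Matrix (Fin 2) (Fin 2) D)ˣ)
    (hUplus : Uplus = {g : (Matrix (Fin 2) (Fin 2) D)ˣ |
      ∃ a : D, Units.val g = !![1, a; 0, 1]})
    (hUminus : Uminus = {g : (Matrix (Fin 2) (Fin 2) D)ˣ |
      ∃ a : D, Units.val g = !![1, 0; a, 1]})
    (x y : D) (hx : x ≠ 0) (hy : y ≠ 0) :
    ∃ g ∈ Subgroup.closure (Uplus ∪ Uminus),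
      Units.val g = !![x * y * x⁻¹ * y⁻¹, 0; 0, 1] := by
  have hu (a : D) : Matrix.upperUnipotent a ∈ Subgroup.closure (Uplus ∪ Uminus) :=
    Subgroup.subset_closure (Or.inl (hUplus ▸ ⟨a, rfl⟩))
  have hl (a : D) : Matrix.lowerUnipotent a ∈ Subgroup.closure (Uplus ∪ Uminus) :=
    Subgroup.subset_closure (Or.inr (hUminus ▸ ⟨a, rfl⟩))
  obtain ⟨g, hg, hgx⟩ := Matrix.exists_mem_val_eq_diag_inv hu hl hx
  obtain ⟨h, hh, hhy⟩ := Matrix.exists_mem_val_eq_diag_inv hu hl hy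
  obtain ⟨k, hk, hkyx⟩ :=
    Matrix.exists_mem_val_eq_diag_inv hu hl (inv_ne_zero (mul_ne_zero hy hx))
  refine ⟨g * h * k, mul_mem (mul_mem hg hh) hk, ?_⟩
  simp [hgx, hhy, hkyx, mul_assoc, hx, hy]
end

section
/- Let D be a division ring, let O ⊆ D be a subring, and let ϖ ∈ O be a nonzero element such that for every x ∈ D there exists n ∈ ℕ with ϖⁿ x ϖⁿ ∈ O. Let η = diag(1, ϖ) ∈ GL₂(D), and let GL₂(O) ⊆ GL₂(D) denote the subgroup of matrices g with entries in O such that g⁻¹ also has entries in O. Then the subgroup of GL₂(D) generated by GL₂(O) and η GL₂(O) η⁻¹ contains every matrix of U⁺ ∪ U⁻ (and hence contains the subgroup generated by all elementary unipotent matrices). -/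
/-- The upper unipotent matrix with off-diagonal entry `x`, as a unit. -/
def upperUnipotent {R : Type*} [Ring R] (x : R) : (Matrix (Fin 2) (Fin 2) R)ˣ where
  val := !![1, x; 0, 1]
  inv := !![1, -x; 0, 1]
  val_inv := by simp [Matrix.one_fin_two]
  inv_val := by simp [Matrix.one_fin_two]

/-- The Weyl element, as a unit. -/
def weylElement (R : Type*) [Ring R] : (Matrix (Fin 2) (Fin 2) R)ˣ where
  val := !![0, 1; -1, 0]
  inv := !![0, -1; 1, 0]
  val_inv := by simp [Matrix.one_fin_two]
  inv_val := by simp [Matrix.one_fin_two]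

/-- Conjugation by the Weyl element exchanges upper and lower unipotent matrices. -/
theorem val_weylElement_conj_upperUnipotent {R : Type*} [Ring R] (x : R) :
    Units.val (weylElement R * upperUnipotent x * (weylElement R)⁻¹) = !![1, 0; -x, 1] := by
  change !![0, 1; -1, 0] * !![1, x; 0, 1] * !![0, -1; 1, 0] = _
  simp

/-- The product of the Weyl element with its conjugate by `diag(1, ϖ)` is
`diag(-ϖ, -ϖ⁻¹)`. -/
theorem val_weylElement_mul_conj {D : Type*} [DivisionRing D] {ϖ : D} (hϖ : ϖ ≠ 0)
    {η : (Matrix (Fin 2) (Fin 2) D)ˣ} (hη : Units.val η = !![1, 0; 0, ϖ]) :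
    Units.val (weylElement D * (η * weylElement D * η⁻¹)) = !![-ϖ, 0; 0, -ϖ⁻¹] := by
  have hη_inv : Units.val η⁻¹ = !![1, 0; 0, ϖ⁻¹] := by
    rw [Units.inv_eq_of_mul_eq_one_right]
    simp [hη, hϖ, Matrix.one_fin_two]
  rw [Units.val_mul, Units.val_mul, Units.val_mul, hη, hη_inv]
  change !![0, 1; -1, 0] * (!![1, 0; 0, ϖ] * !![0, 1; -1, 0] * !![1, 0; 0, ϖ⁻¹]) = _
  simp

/-- A subgroup containing `diag(-ϖ, -ϖ⁻¹)` and the upper unipotent matrices with entries in `S`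
contains every upper unipotent matrix whose entry is brought into `S` by multiplication by a power
of `ϖ` on both sides. -/
theorem upperUnipotent_mem_of_pow_mul_mul_pow_mem {D : Type*} [DivisionRing D] {S : Set D} {ϖ : D}
    (hϖ : ϖ ≠ 0) {H : Subgroup (Matrix (Fin 2) (Fin 2) D)ˣ}
    (hS : ∀ x ∈ S, upperUnipotent x ∈ H) {t : (Matrix (Fin 2) (Fin 2) D)ˣ} (ht : t ∈ H)
    (ht_val : Units.val t = !![-ϖ, 0; 0, -ϖ⁻¹]) (n : ℕ) (x : D)
    (hx : ϖ ^ n * x * ϖ ^ n ∈ S) : upperUnipotent x ∈ H := by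
  induction n generalizing x with
  | zero => exact hS x (by simpa using hx)
  | succ n ih =>
    have hmem : upperUnipotent (ϖ * x * ϖ) ∈ H := by
      refine ih _ ?_
      rwa [show ϖ ^ n * (ϖ * x * ϖ) * ϖ ^ n = ϖ ^ (n + 1) * x * ϖ ^ (n + 1) by
        simp only [pow_succ ϖ n, ← pow_mul_comm' ϖ n, mul_assoc]]
    have hconj : t * upperUnipotent x = upperUnipotent (ϖ * x * ϖ) * t := by
      apply Units.ext
      rw [Units.val_mul, Units.val_mul, ht_val]
      change _ * !![1, x; 0, 1] = !![1, ϖ * x * ϖ; 0, 1] * _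
      simp [mul_assoc, hϖ]
    rw [← H.mul_mem_cancel_left ht, hconj]
    exact H.mul_mem hmem ht

/-- Let `D` be a division ring, `O ⊆ D` a subring, and `ϖ ∈ O` a nonzero element such that
for every `x ∈ D` there is `n : ℕ` with `ϖⁿ x ϖⁿ ∈ O`. Let `η = diag(1, ϖ) ∈ GL₂(D)` and
let `GL₂(O)` be the subgroup of `GL₂(D)` of matrices `g` such that both `g` and `g⁻¹` have
all entries in `O`. Then the subgroup of `GL₂(D)` generated by `GL₂(O)` and
`η GL₂(O) η⁻¹` contains every elementary unipotent matrix, i.e. it contains `U⁺ ∪ U⁻`. -/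
theorem stmt6 {D : Type*} [DivisionRing D] (O : Subring D) (ϖ : D)
    (hϖO : ϖ ∈ O) (hϖ : ϖ ≠ 0)
    (hbound : ∀ x : D, ∃ n : ℕ, ϖ ^ n * x * ϖ ^ n ∈ O)
    (η : (Matrix (Fin 2) (Fin 2) D)ˣ) (hη : Units.val η = !![1, 0; 0, ϖ])
    (GL2O : Set (Matrix (Fin 2) (Fin 2) D)ˣ)
    (hGL2O : GL2O = {g : (Matrix (Fin 2) (Fin 2) D)ˣ |
      (∀ i j, Units.val g i j ∈ O) ∧ (∀ i j, Units.val g⁻¹ i j ∈ O)})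
    (Uplus Uminus : Set (Matrix (Fin 2) (Fin 2) D)ˣ)
    (hUplus : Uplus = {g : (Matrix (Fin 2) (Fin 2) D)ˣ |
      ∃ x : D, Units.val g = !![1, x; 0, 1]})
    (hUminus : Uminus = {g : (Matrix (Fin 2) (Fin 2) D)ˣ |
      ∃ x : D, Units.val g = !![1, 0; x, 1]}) :
    Uplus ∪ Uminus ⊆
      ↑(Subgroup.closure (GL2O ∪ ((fun g => η * g * η⁻¹) '' GL2O))) := by
  subst hGL2O hUplus hUminus
  set H : Subgroup (Matrix (Fin 2) (Fin 2) D)ˣ := Subgroup.closure _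
  have hw : weylElement D ∈ {g : (Matrix (Fin 2) (Fin 2) D)ˣ |
      (∀ i j, Units.val g i j ∈ O) ∧ (∀ i j, Units.val g⁻¹ i j ∈ O)} := by
    constructor <;> intro i j <;> fin_cases i <;> fin_cases j <;>
      simp [weylElement, O.zero_mem, O.one_mem]
  have hwH : weylElement D ∈ H := Subgroup.subset_closure (Or.inl hw)
  have hu : ∀ x ∈ O, upperUnipotent x ∈ H := by
    refine fun x hx => Subgroup.subset_closure (Or.inl ?_)
    constructor <;> intro i j <;> fin_cases i <;> fin_cases j <;>
      simp [upperUnipotent, O.zero_mem, O.one_mem, hx]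
  have hU : ∀ x, upperUnipotent x ∈ H := fun x =>
    (hbound x).elim fun n => upperUnipotent_mem_of_pow_mul_mul_pow_mem (S := O) hϖ hu
      (H.mul_mem hwH (Subgroup.subset_closure (Or.inr ⟨_, hw, rfl⟩)))
      (val_weylElement_mul_conj hϖ hη) n x
  rintro g (⟨x, hx⟩ | ⟨x, hx⟩)
  · rw [show g = upperUnipotent x from Units.ext hx]
    exact hU x
  · rw [show g = weylElement D * upperUnipotent (-x) * (weylElement D)⁻¹ from
      Units.ext (by rw [hx, val_weylElement_conj_upperUnipotent, neg_neg])]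
    exact H.mul_mem (H.mul_mem hwH (hU _)) (H.inv_mem hwH)
end

section
/- Let F be a finite field with q elements, and let m ≥ 1 and 0 ≤ i ≤ m be integers. Then the natural number q^{i(m−i)} · |GL_i(F)| · |GL_{m−i}(F)| divides |GL_m(F)|. (The quotient is the Gaussian binomial coefficient binom_q(m, i).) -/
open Matrix

/-- The invertible block upper triangular matrix with diagonal blocks `A`, `D` and upper right
block `B`. -/
def blockUpperGL {F m n : Type*} [CommRing F] [Fintype m] [DecidableEq m] [Fintype n]
    [DecidableEq n] (B : Matrix m n F) (A : GL m F) (D : GL n F) : GL (m ⊕ n) F where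
  val := fromBlocks A.val B 0 D.val
  inv := fromBlocks A⁻¹.val (-(A⁻¹.val * B * D⁻¹.val)) 0 D⁻¹.val
  val_inv := by
    have h : A.val * A⁻¹.val = 1 := A.mul_inv
    have h' : D.val * D⁻¹.val = 1 := D.mul_inv
    rw [fromBlocks_multiply, Matrix.mul_neg, ← Matrix.mul_assoc, ← Matrix.mul_assoc, h, h']
    simp
  inv_val := by
    have h : A⁻¹.val * A.val = 1 := A.inv_mul
    have h' : D⁻¹.val * D.val = 1 := D.inv_mul
    rw [fromBlocks_multiply, Matrix.neg_mul, Matrix.mul_assoc _ D⁻¹.val, h, h']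
    simp

theorem blockUpperGL_injective {F m n : Type*} [CommRing F] [Fintype m] [DecidableEq m]
    [Fintype n] [DecidableEq n] :
    Function.Injective fun (B, A, D) => blockUpperGL (F := F) (m := m) (n := n) B A D := by
  rintro ⟨B, A, D⟩ ⟨B', A', D'⟩ h
  obtain ⟨hA, hB, -, hD⟩ := fromBlocks_inj.1 (congrArg Units.val h)
  exact Prod.ext hB (Prod.ext (Units.ext hA) (Units.ext hD))

/-- The parabolic subgroup of block upper triangular matrices. -/
def blockUpperSubgroup (F m n : Type*) [CommRing F] [Fintype m] [DecidableEq m] [Fintype n]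
    [DecidableEq n] : Subgroup (GL (m ⊕ n) F) where
  carrier := Set.range fun (B, A, D) => blockUpperGL B A D
  one_mem' := ⟨(0, 1, 1), Units.ext (by simp [blockUpperGL])⟩
  mul_mem' := by
    rintro _ _ ⟨⟨B, A, D⟩, rfl⟩ ⟨⟨B', A', D'⟩, rfl⟩
    exact ⟨(A.val * B' + B * D'.val, A * A', D * D'), Units.ext (by
      simp [blockUpperGL, fromBlocks_multiply])⟩
  inv_mem' := by
    rintro _ ⟨⟨B, A, D⟩, rfl⟩
    exact ⟨(-(A⁻¹.val * B * D⁻¹.val), A⁻¹, D⁻¹), Units.ext rfl⟩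

theorem card_blockUpperSubgroup (F m n : Type*) [CommRing F] [Fintype m] [DecidableEq m]
    [Fintype n] [DecidableEq n] :
    Nat.card (blockUpperSubgroup F m n) =
      Nat.card F ^ (Fintype.card m * Fintype.card n) * Nat.card (GL m F) * Nat.card (GL n F) := by
  have h : Nat.card (Matrix m n F) = Nat.card F ^ (Fintype.card m * Fintype.card n) := by
    rw [mul_comm, pow_mul]
    simp [Matrix, Nat.card_fun]
  rw [← h, mul_assoc, ← Nat.card_prod, ← Nat.card_prod]
  exact (Nat.card_congr (Equiv.ofInjective _ blockUpperGL_injective)).symm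

/-- Let `F` be a finite field with `q` elements, `m ≥ 1`, `0 ≤ i ≤ m`. Then
`q^(i(m−i)) · |GL_i(F)| · |GL_{m−i}(F)|` divides `|GL_m(F)|`. -/
theorem stmt8 {F : Type*} [Field F] [Fintype F] (q : ℕ) (hq : q = Fintype.card F)
    (m i : ℕ) (hm : 1 ≤ m) (hi : i ≤ m) :
    q ^ (i * (m - i)) * Nat.card (GL (Fin i) F) * Nat.card (GL (Fin (m - i)) F) ∣
      Nat.card (GL (Fin m) F) := by
  have h := (blockUpperSubgroup F (Fin i) (Fin (m - i))).card_subgroup_dvd_card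
  let e : Fin i ⊕ Fin (m - i) ≃ Fin m := finSumFinEquiv.trans (finCongr (by omega))
  rw [card_blockUpperSubgroup, Fintype.card_fin, Fintype.card_fin, Nat.card_eq_fintype_card,
    ← hq] at h
  rwa [← Nat.card_congr (Units.mapEquiv (reindexAlgEquiv F F e).toMulEquiv).toEquiv]
end
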